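/- Let H = H(2^a, 2^b; 2^c, 2^d+1) with d > 1 and max{d, a−d−1} < c < min{a, b}. There exists an automorphism σ of H with σ(α) = α^{x₁}β^{y₁} and σ(β) = α^{x₂}β^{y₂} if and only if: 2^{b−d} ∣ y₁; x₂[2^b; r^{y₂}] + 2^c y₂ − x₁[2^c; r^{y₁}] − (y₁/2^b)·2^{2c} ≡ 0 (mod 2^a); (r^{y₁}−1)x₂ + ([r; r^{y₁}] − r^{y₂})x₁ + ((r−1)y₁/2^b)·2^c ≡ 0 (mod 2^a); and x₁y₂ − x₂y₁ is odd, where r = 2^d + 1. -/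

import Mathlib

/-- Relators for the metacyclic presentation
`⟨α, β ∣ α^n = 1, β^m = α^t, β α β⁻¹ = α^r⟩` (generator `true ↦ α`, `false ↦ β`). -/
def metacyclicRels (n m t r : ℕ) : Set (FreeGroup Bool) :=
  {FreeGroup.of true ^ n,
   FreeGroup.of false ^ m * (FreeGroup.of true ^ t)⁻¹,
   FreeGroup.of false * FreeGroup.of true * (FreeGroup.of false)⁻¹ *
     (FreeGroup.of true ^ r)⁻¹}

/-- The metacyclic group `H(n, m; t, r)`. -/
abbrev Metacyclic (n m t r : ℕ) := PresentedGroup (metacyclicRels n m t r)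

open Finset

theorem mul_zpow_pow_of_semiconjBy {G : Type*} [Group G] {α β : G} {y s : ℤ}
    (h : SemiconjBy (β ^ y) α (α ^ s)) (x : ℤ) (n : ℕ) :
    (α ^ x * β ^ y) ^ n = α ^ (x * ∑ i ∈ range n, s ^ i) * β ^ (y * n) := by
  induction n with
  | zero => simp
  | succ n ih =>
    have h' := (h.zpow_right (x * ∑ i ∈ range n, s ^ i)).eq
    rw [pow_succ', ih, geom_sum_succ, mul_assoc, ← mul_assoc (β ^ y), h', ← zpow_mul,
      mul_assoc, ← zpow_add, ← mul_assoc, ← zpow_add]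
    congr 2 <;> push_cast <;> ring

theorem SemiconjBy.pow_left_pow {G : Type*} [Group G] {α β : G} {r : ℕ}
    (h : SemiconjBy β α (α ^ r)) (k : ℕ) : SemiconjBy (β ^ k) α (α ^ r ^ k) := by
  induction k with
  | zero => simp
  | succ k ih =>
    rw [pow_succ' β, pow_succ r, pow_mul']
    exact (h.pow_right _).mul_left ih

theorem two_pow_dvd_geom_sum_of_odd {s : ℤ} (hs : Odd s) (n : ℕ) :
    (2 : ℤ) ^ n ∣ ∑ i ∈ range (2 ^ n), s ^ i := by
  induction n with
  | zero => simp
  | succ n ih =>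
    have : ∑ i ∈ range (2 ^ (n + 1)), s ^ i =
        (∑ i ∈ range (2 ^ n), s ^ i) * (1 + s ^ 2 ^ n) := by
      rw [pow_succ, mul_two, sum_range_add, mul_add, mul_one, sum_mul]
      congr 1
      exact sum_congr rfl fun i _ => by ring
    rw [this, pow_succ]
    exact mul_dvd_mul ih (hs.pow.one_add).two_dvd

theorem two_pow_dvd_pow_two_pow_sub_one (d n : ℕ) (hd : 0 < d) :
    (2 : ℤ) ^ (d + n) ∣ (2 ^ d + 1) ^ 2 ^ n - 1 := by
  have hodd : Odd ((2 : ℤ) ^ d + 1) := by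
    have : Even ((2 : ℤ) ^ d) := (even_two).pow_of_ne_zero hd.ne'
    exact this.add_one
  have h := mul_dvd_mul_left ((2 : ℤ) ^ d) (two_pow_dvd_geom_sum_of_odd hodd n)
  have h2 := mul_geom_sum ((2 : ℤ) ^ d + 1) (2 ^ n)
  rw [add_sub_cancel_right] at h2
  rwa [h2, ← pow_add] at h

/-- The pair `x, y` satisfies the defining relations of the metacyclic group `H(n, m; t, r)`. -/
structure IsMetacyclicPair {G : Type*} [Group G] (n m t r : ℕ) (x y : G) : Prop where
  pow_eq_one : x ^ n = 1
  pow_eq_pow : y ^ m = x ^ t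
  semiconj : SemiconjBy y x (x ^ r)

theorem Metacyclic.isMetacyclicPair_of (n m t r : ℕ) :
    IsMetacyclicPair n m t r (PresentedGroup.of true : Metacyclic n m t r)
      (PresentedGroup.of false) where
  pow_eq_one := PresentedGroup.one_of_mem (rels := metacyclicRels n m t r)
    (x := FreeGroup.of true ^ n) (by simp [metacyclicRels])
  pow_eq_pow := PresentedGroup.mk_eq_mk_of_mul_inv_mem (rels := metacyclicRels n m t r)
    (x := FreeGroup.of false ^ m) (y := FreeGroup.of true ^ t) (by simp [metacyclicRels])
  semiconj := mul_inv_eq_iff_eq_mul.mp <|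
    PresentedGroup.mk_eq_mk_of_mul_inv_mem (rels := metacyclicRels n m t r)
      (x := FreeGroup.of false * FreeGroup.of true * (FreeGroup.of false)⁻¹)
      (y := FreeGroup.of true ^ r) (by simp [metacyclicRels])

namespace IsMetacyclicPair

theorem exists_hom {G : Type*} [Group G] {n m t r : ℕ} {x y : G}
    (h : IsMetacyclicPair n m t r x y) :
    ∃ f : Metacyclic n m t r →* G,
      f (PresentedGroup.of true) = x ∧ f (PresentedGroup.of false) = y := by
  have hrel : ∀ w ∈ metacyclicRels n m t r,
      FreeGroup.lift (fun i : Bool => if i then x else y) w = 1 := by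
    rintro w (rfl | rfl | rfl)
    · simpa using h.pow_eq_one
    · simpa [mul_inv_eq_one] using h.pow_eq_pow
    · simpa [mul_inv_eq_one, mul_inv_eq_iff_eq_mul] using h.semiconj.eq
  exact ⟨PresentedGroup.toGroup hrel, by simp, by simp⟩

theorem map {G K : Type*} [Group G] [Group K] {n m t r : ℕ} {x y : G}
    (h : IsMetacyclicPair n m t r x y) (f : G →* K) : IsMetacyclicPair n m t r (f x) (f y) where
  pow_eq_one := by rw [← map_pow, h.pow_eq_one, map_one]
  pow_eq_pow := by rw [← map_pow, ← map_pow, h.pow_eq_pow]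
  semiconj := by simpa using h.semiconj.map f

theorem semiconjBy_zpow {G : Type*} [Group G] {n m t r : ℕ} {x y : G}
    (h : IsMetacyclicPair n m t r x y) (hm : m ≠ 0) (k : ℤ) :
    SemiconjBy (y ^ k) x (x ^ (r : ℤ) ^ (k % m).toNat) := by
  have hk : y ^ k = y ^ (k % m).toNat * x ^ (t * (k / m)) := by
    rw [← zpow_natCast y, Int.toNat_of_nonneg (Int.emod_nonneg k (by exact_mod_cast hm)),
      zpow_mul, zpow_natCast, ← h.pow_eq_pow, ← zpow_natCast, ← zpow_mul, ← zpow_add,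
      Int.emod_add_mul_ediv]
  have hs := h.semiconj.pow_left_pow (k % m).toNat
  rw [← zpow_natCast x, Nat.cast_pow] at hs
  rw [hk]
  exact hs.mul_left (Commute.zpow_self x _)

theorem mul_zpow_pow {G : Type*} [Group G] {n m t r : ℕ} {x y : G}
    (h : IsMetacyclicPair n m t r x y) (hm : m ≠ 0) (i j : ℤ) (N : ℕ) :
    (x ^ i * y ^ j) ^ N =
      x ^ (i * ∑ l ∈ range N, ((r : ℤ) ^ (j % m).toNat) ^ l) * y ^ (j * N) :=
  mul_zpow_pow_of_semiconjBy (h.semiconjBy_zpow hm j) i N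

theorem mul_zpow_mul_mul_zpow {G : Type*} [Group G] {n m t r : ℕ} {x y : G}
    (h : IsMetacyclicPair n m t r x y) (hm : m ≠ 0) (i j k l : ℤ) :
    x ^ i * y ^ j * (x ^ k * y ^ l) =
      x ^ (i + (r : ℤ) ^ (j % m).toNat * k) * y ^ (j + l) := by
  have := ((h.semiconjBy_zpow hm j).zpow_right k).eq
  rw [zpow_add, zpow_add, zpow_mul, mul_assoc, ← mul_assoc (y ^ j), this]
  simp only [mul_assoc]

end IsMetacyclicPair

namespace Metacyclic

open Multiplicative in
/-- Normal form in `H(n, m; t, r)`: the hypotheses are those ensuring order `n * m`. -/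
theorem exists_of_zpow_mul_zpow_eq_one {n m t r : ℕ} (hr : IsCoprime (r : ℤ) n)
    (hm : (n : ℤ) ∣ r ^ m - 1) (ht : (n : ℤ) ∣ t * (r - 1)) {i j : ℤ}
    (h : (PresentedGroup.of true : Metacyclic n m t r) ^ i * PresentedGroup.of false ^ j = 1) :
    ∃ k : ℤ, j = m * k ∧ (n : ℤ) ∣ i + t * k := by
  obtain ⟨u, hu⟩ : IsUnit (r : ZMod n) := by
    have := (ZMod.isUnit_iff_coprime r n).mpr (Nat.isCoprime_iff_coprime.mp hr)
    exact this
  let e : MulAut (Multiplicative (ZMod n)) :=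
    AddEquiv.toMultiplicative (DistribMulAction.toAddEquiv (ZMod n) u)
  have he : ∀ x : ZMod n, e (ofAdd x) = ofAdd ((r : ZMod n) * x) := fun x => by
    rw [← hu]; rfl
  have hek : ∀ (k : ℕ) (x : ZMod n), (e ^ k) (ofAdd x) = ofAdd ((r : ZMod n) ^ k * x) := by
    intro k
    induction k with
    | zero => simp
    | succ k ih => intro x; rw [pow_succ, MulAut.mul_apply, he, ih, pow_succ, mul_assoc]
  have hrm : (r : ZMod n) ^ m = 1 := by
    have := (ZMod.intCast_zmod_eq_zero_iff_dvd _ n).mpr hm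
    push_cast at this
    exact sub_eq_zero.mp this
  have htr : (r : ZMod n) * t = t := by
    have := (ZMod.intCast_zmod_eq_zero_iff_dvd _ n).mpr ht
    push_cast at this
    linear_combination this
  have hem : e ^ m = 1 := by
    ext x
    obtain ⟨x, rfl⟩ := ofAdd.surjective x
    rw [hek, hrm, one_mul]; rfl
  have het : ∀ k : ℤ, (e ^ k) (ofAdd (t : ZMod n)) = ofAdd (t : ZMod n) := by
    intro k
    have : e ∈ MulAction.stabilizer (MulAut (Multiplicative (ZMod n))) (ofAdd (t : ZMod n)) := by
      rw [MulAction.mem_stabilizer_iff, MulAut.smul_def, he, htr]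
    exact MulAction.mem_stabilizer_iff.mp (zpow_mem this k)
  let φ := zpowersHom (MulAut (Multiplicative (ZMod n))) e
  let x : Multiplicative (ZMod n) ⋊[φ] Multiplicative ℤ := SemidirectProduct.inl (ofAdd 1)
  let y : Multiplicative (ZMod n) ⋊[φ] Multiplicative ℤ := SemidirectProduct.inr (ofAdd 1)
  have hx : ∀ k : ℤ, x ^ k = SemidirectProduct.inl (ofAdd (k : ZMod n)) := fun k => by
    rw [← map_zpow, ← ofAdd_zsmul]; simp
  have hy : ∀ k : ℤ, y ^ k = SemidirectProduct.inr (ofAdd k) := fun k => by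
    rw [← map_zpow, ← ofAdd_zsmul]; simp
  have hx' : ∀ k : ℕ, x ^ k = SemidirectProduct.inl (ofAdd (k : ZMod n)) := fun k => by
    simpa using hx k
  have hy' : ∀ k : ℕ, y ^ k = SemidirectProduct.inr (ofAdd (k : ℤ)) := fun k => by
    simpa using hy k
  have hxt : ∀ g : Multiplicative (ZMod n) ⋊[φ] Multiplicative ℤ, x ^ t * g = g * x ^ t := by
    intro g
    rw [hx']
    ext
    · simp only [SemidirectProduct.mul_left, SemidirectProduct.left_inl,
        SemidirectProduct.right_inl, map_one, MulAut.one_apply]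
      rw [mul_comm]
      exact congrArg (g.left * ·) (het (toAdd g.right)).symm
    · simp [mul_comm]
  have hym : ∀ g : Multiplicative (ZMod n) ⋊[φ] Multiplicative ℤ, y ^ m * g = g * y ^ m := by
    intro g
    rw [hy']
    ext
    · have : φ (ofAdd (m : ℤ)) = 1 := by
        simp [φ, hem]
      simp [this]
    · simp [mul_comm]
  let z : Multiplicative (ZMod n) ⋊[φ] Multiplicative ℤ := (x ^ t)⁻¹ * y ^ m
  have hz : ∀ g : Multiplicative (ZMod n) ⋊[φ] Multiplicative ℤ, z * g = g * z := by
    intro g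
    rw [mul_assoc, hym, ← mul_assoc, ← mul_assoc]
    congr 1
    exact (Commute.inv_left (hxt g)).eq
  let Z : Subgroup (Multiplicative (ZMod n) ⋊[φ] Multiplicative ℤ) := Subgroup.zpowers z
  have : Z.Normal := ⟨by
    rintro _ ⟨k, rfl⟩ g
    have : g * z ^ k * g⁻¹ = z ^ k := by
      rw [mul_inv_eq_iff_eq_mul]
      exact ((show Commute z g from hz g).zpow_left k).eq.symm
    simp only [this]
    exact ⟨k, rfl⟩⟩
  have hpair : IsMetacyclicPair n m t r (x : _ ⧸ Z) (y : _ ⧸ Z) := by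
    refine ⟨?_, ?_, ?_⟩
    · rw [← QuotientGroup.mk_pow, hx']
      simp
    · rw [← QuotientGroup.mk_pow, ← QuotientGroup.mk_pow, eq_comm, QuotientGroup.eq]
      exact Subgroup.mem_zpowers z
    · rw [← QuotientGroup.mk_pow]
      have : SemiconjBy y x (x ^ r) := by
        rw [hx', ← mul_one (r : ZMod n), ← he]
        have := SemidirectProduct.inl_aut (φ := φ) (ofAdd 1) (ofAdd 1)
        rw [map_inv, eq_mul_inv_iff_mul_eq] at this
        simpa [φ, SemiconjBy] using this.symm
      exact this.map (QuotientGroup.mk' Z)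
  obtain ⟨f, hfx, hfy⟩ := hpair.exists_hom
  have h1 := congrArg f h
  rw [map_mul, map_zpow, map_zpow, hfx, hfy, map_one, ← QuotientGroup.mk_zpow,
    ← QuotientGroup.mk_zpow, ← QuotientGroup.mk_mul, QuotientGroup.eq_one_iff] at h1
  obtain ⟨k, hk⟩ := h1
  have hk : z ^ k = x ^ i * y ^ j := hk
  have hzk : z ^ k = x ^ (-(t * k) : ℤ) * y ^ (m * k : ℤ) := by
    have hc : Commute (x ^ t)⁻¹ (y ^ m) := Commute.inv_left (hxt _)
    rw [hc.mul_zpow, zpow_neg, zpow_mul, zpow_mul, inv_zpow, zpow_natCast, zpow_natCast]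
  rw [hzk, hx, hy, hx, hy] at hk
  refine ⟨k, ?_, ?_⟩
  · have := congrArg SemidirectProduct.right hk
    simp only [SemidirectProduct.mul_right, SemidirectProduct.right_inl,
      SemidirectProduct.right_inr, one_mul] at this
    exact (ofAdd.injective this).symm
  · have := congrArg SemidirectProduct.left hk
    simp only [SemidirectProduct.mul_left, SemidirectProduct.left_inl, SemidirectProduct.left_inr,
      map_one, mul_one] at this
    have h3 : ((-(t * k) : ℤ) : ZMod n) = (i : ZMod n) := ofAdd.injective this
    rw [ZMod.intCast_eq_intCast_iff_dvd_sub] at h3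
    simpa using h3


section

variable {n m t r : ℕ}

local notation "α" => (PresentedGroup.of true : Metacyclic n m t r)
local notation "β" => (PresentedGroup.of false : Metacyclic n m t r)

theorem zpow_mul_zpow_eq_iff (hr : IsCoprime (r : ℤ) n) (hm : (n : ℤ) ∣ r ^ m - 1)
    (ht : (n : ℤ) ∣ t * (r - 1)) {i j k l : ℤ} :
    α ^ i * β ^ j = α ^ k * β ^ l ↔ ∃ q : ℤ, j - l = m * q ∧ (n : ℤ) ∣ i - k + t * q := by
  have key : α ^ i * β ^ j = α ^ k * β ^ l ↔ α ^ (i - k) * β ^ (j - l) = 1 := by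
    rw [sub_eq_neg_add, zpow_add, zpow_neg, zpow_sub, mul_assoc, ← mul_assoc (α ^ i),
      inv_mul_eq_one, eq_mul_inv_iff_mul_eq, eq_comm]
  rw [key]
  refine ⟨exists_of_zpow_mul_zpow_eq_one hr hm ht, ?_⟩
  rintro ⟨q, hq, s, hs⟩
  have h := isMetacyclicPair_of n m t r
  rw [hq, zpow_mul β, zpow_natCast, h.pow_eq_pow, ← zpow_natCast, ← zpow_mul, ← zpow_add, hs,
    zpow_mul, zpow_natCast, h.pow_eq_one, one_zpow]

theorem exists_eq_zpow_mul_zpow (hm : m ≠ 0) (g : Metacyclic n m t r) :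
    ∃ i j : ℤ, g = α ^ i * β ^ j := by
  have h := isMetacyclicPair_of n m t r
  have hg : g ∈ Subgroup.closure
      (Set.range (PresentedGroup.of (rels := metacyclicRels n m t r))) := by
    rw [PresentedGroup.closure_range_of]; trivial
  induction hg using Subgroup.closure_induction with
  | mem x hx =>
    obtain ⟨_ | _, rfl⟩ := hx
    · exact ⟨0, 1, by simp⟩
    · exact ⟨1, 0, by simp⟩
  | one => exact ⟨0, 0, by simp⟩
  | mul x y _ _ hx hy =>
    obtain ⟨i, j, rfl⟩ := hx
    obtain ⟨k, l, rfl⟩ := hy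
    exact ⟨_, _, h.mul_zpow_mul_mul_zpow hm i j k l⟩
  | inv x _ hx =>
    obtain ⟨i, j, rfl⟩ := hx
    refine ⟨(r : ℤ) ^ (-j % m).toNat * -i, -j, ?_⟩
    simpa using h.mul_zpow_mul_mul_zpow hm 0 (-j) (-i) 0

theorem finite (hn : n ≠ 0) (hm : m ≠ 0) : Finite (Metacyclic n m t r) := by
  have h := isMetacyclicPair_of n m t r
  have hα : IsOfFinOrder α := isOfFinOrder_iff_pow_eq_one.mpr ⟨n, hn.bot_lt, h.pow_eq_one⟩
  have hβ : IsOfFinOrder β := by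
    refine isOfFinOrder_iff_pow_eq_one.mpr ⟨m * n, (mul_ne_zero hm hn).bot_lt, ?_⟩
    rw [pow_mul, h.pow_eq_pow, pow_right_comm, h.pow_eq_one, one_pow]
  rw [← Set.finite_univ_iff]
  refine ((finite_zpowers.mpr hα).image2 (· * ·) (finite_zpowers.mpr hβ)).subset ?_
  intro g _
  obtain ⟨i, j, rfl⟩ := exists_eq_zpow_mul_zpow hm g
  exact ⟨_, ⟨i, rfl⟩, _, ⟨j, rfl⟩, rfl⟩

theorem isPGroup {p e f : ℕ} (hp : p ≠ 0) (hn : n = p ^ e) (hm : m = p ^ f) :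
    IsPGroup p (Metacyclic n m t r) := by
  have h := isMetacyclicPair_of n m t r
  have hm0 : m ≠ 0 := hm ▸ pow_ne_zero f hp
  intro g
  obtain ⟨i, j, rfl⟩ := exists_eq_zpow_mul_zpow hm0 g
  refine ⟨f + e, ?_⟩
  rw [pow_add, pow_mul, ← hn, ← hm, h.mul_zpow_pow hm0, mul_comm j, zpow_mul β, zpow_natCast,
    h.pow_eq_pow, ← zpow_natCast _ t, ← zpow_mul, ← zpow_add, ← zpow_natCast, zpow_comm,
    zpow_natCast, h.pow_eq_one, one_zpow]

end

end Metacyclic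

theorem IsPGroup.exists_index_eq_of_ne_top {p : ℕ} [Fact p.Prime] {G : Type*} [Group G] [Finite G]
    (hG : IsPGroup p G) {K : Subgroup G} (hK : K ≠ ⊤) : ∃ M : Subgroup G, K ≤ M ∧ M.index = p := by
  obtain ⟨N, hN⟩ := IsPGroup.iff_card.mp hG
  obtain ⟨k, hk⟩ := IsPGroup.iff_card.mp (hG.to_subgroup K)
  have hp := (Fact.out : p.Prime)
  have hkN : k < N := by
    rw [← Nat.pow_lt_pow_iff_right hp.one_lt, ← hk, ← hN]
    exact lt_of_le_of_ne (Subgroup.card_le_card_group K) fun h =>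
      hK (Subgroup.card_eq_iff_eq_top K |>.mp h)
  obtain ⟨N, rfl⟩ : ∃ N', N = N' + 1 := ⟨N - 1, by omega⟩
  obtain ⟨M, hM, hKM⟩ := Sylow.exists_subgroup_card_pow_prime_le p (m := N)
    (hN ▸ pow_dvd_pow p N.le_succ) K hk (by omega)
  refine ⟨M, hKM, ?_⟩
  have := M.card_mul_index
  rw [hM, hN, pow_succ] at this
  exact Nat.eq_of_mul_eq_mul_left (pow_pos hp.pos N) this

theorem Subgroup.zpow_mem_iff_of_index_two {G : Type*} [Group G] {M : Subgroup G}
    (hM : M.index = 2) (g : G) (k : ℤ) : g ^ k ∈ M ↔ Even k ∨ g ∈ M := by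
  have hsq : ∀ q : ℤ, g ^ (q + q) ∈ M := fun q => by
    rw [zpow_add, Subgroup.mul_mem_iff_of_index_two hM]
  rcases Int.even_or_odd' k with ⟨q, rfl | rfl⟩
  · simpa [two_mul] using hsq q
  · rw [zpow_add, zpow_one, Subgroup.mul_mem_iff_of_index_two hM, two_mul]
    simp [hsq q]

namespace Metacyclic

theorem surjective_of_odd {a b t r : ℕ} {x₁ x₂ y₁ y₂ : ℤ}
    (hodd : Odd (x₁ * y₂ - x₂ * y₁))
    (f : Metacyclic (2 ^ a) (2 ^ b) t r →* Metacyclic (2 ^ a) (2 ^ b) t r)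
    (hα : f (PresentedGroup.of true) =
      PresentedGroup.of true ^ x₁ * PresentedGroup.of false ^ y₁)
    (hβ : f (PresentedGroup.of false) =
      PresentedGroup.of true ^ x₂ * PresentedGroup.of false ^ y₂) :
    Function.Surjective f := by
  rw [← MonoidHom.range_eq_top]
  by_contra hne
  have := Metacyclic.finite (n := 2 ^ a) (m := 2 ^ b) (t := t) (r := r) (by simp) (by simp)
  obtain ⟨M, hle, hM⟩ := (isPGroup (t := t) (r := r) (p := 2) (e := a) (f := b)
    two_ne_zero rfl rfl).exists_index_eq_of_ne_top hne
  have h1 := hle ⟨_, hα⟩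
  have h2 := hle ⟨_, hβ⟩
  rw [Subgroup.mul_mem_iff_of_index_two hM, Subgroup.zpow_mem_iff_of_index_two hM,
    Subgroup.zpow_mem_iff_of_index_two hM] at h1 h2
  have h3 : (PresentedGroup.of true : Metacyclic (2 ^ a) (2 ^ b) t r) ∈ M ∧
      (PresentedGroup.of false : Metacyclic (2 ^ a) (2 ^ b) t r) ∈ M := by
    rw [← Int.not_even_iff_odd, Int.even_sub, Int.even_mul, Int.even_mul] at hodd
    tauto
  have htop : M = ⊤ := (Subgroup.eq_top_iff' M).mpr
    (PresentedGroup.generated_by _ M (by rintro (_ | _); exacts [h3.2, h3.1]))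
  rw [htop, Subgroup.index_top] at hM
  omega

open Multiplicative in
theorem odd_of_surjective {n m t r : ℕ} (hn : Even n) (hm : Even m) (ht : Even t) (hr : Odd r)
    {x₁ x₂ y₁ y₂ : ℤ} (f : Metacyclic n m t r →* Metacyclic n m t r)
    (hf : Function.Surjective f)
    (hα : f (PresentedGroup.of true) =
      PresentedGroup.of true ^ x₁ * PresentedGroup.of false ^ y₁)
    (hβ : f (PresentedGroup.of false) =
      PresentedGroup.of true ^ x₂ * PresentedGroup.of false ^ y₂) :
    Odd (x₁ * y₂ - x₂ * y₁) := by
  by_contra hodd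
  have hdet : (x₁ * y₂ - x₂ * y₁ : ZMod 2) = 0 := by
    have := ZMod.intCast_eq_zero_iff_even.mpr (Int.not_odd_iff_even.mp hodd)
    exact_mod_cast this
  have hker : ∀ p q s w : ZMod 2, p * w - s * q = 0 →
      ∃ u v : ZMod 2, (u ≠ 0 ∨ v ≠ 0) ∧ p * u + q * v = 0 ∧ s * u + w * v = 0 := by decide
  obtain ⟨u, v, huv, h1, h2⟩ := hker _ _ _ _ hdet
  have hev : ∀ {k : ℕ}, Even k → ∀ w : ZMod 2, ofAdd w ^ k = 1 := fun {k} hk w => by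
    rw [← ofAdd_nsmul, nsmul_eq_mul, ZMod.natCast_eq_zero_iff_even.mpr hk, zero_mul, ofAdd_zero]
  have hpair : IsMetacyclicPair n m t r (ofAdd u) (ofAdd v) := by
    refine ⟨hev hn u, (hev hm v).trans (hev ht u).symm, ?_⟩
    obtain ⟨k, rfl⟩ := hr
    rw [pow_succ, hev (even_two_mul k), one_mul]
    exact Commute.all _ _
  obtain ⟨π, hπα, hπβ⟩ := hpair.exists_hom
  have hzero : π.comp f = 1 := by
    refine PresentedGroup.ext ?_
    rintro (_ | _)
    · rw [MonoidHom.comp_apply, hβ, map_mul, map_zpow, map_zpow, hπα, hπβ, ← ofAdd_zsmul,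
        ← ofAdd_zsmul, ← ofAdd_add, zsmul_eq_mul, zsmul_eq_mul, h2]
      rfl
    · rw [MonoidHom.comp_apply, hα, map_mul, map_zpow, map_zpow, hπα, hπβ, ← ofAdd_zsmul,
        ← ofAdd_zsmul, ← ofAdd_add, zsmul_eq_mul, zsmul_eq_mul, h1]
      rfl
  have hall : ∀ g, π g = 1 := fun g => by
    obtain ⟨g, rfl⟩ := hf g
    exact DFunLike.congr_fun hzero g
  rcases huv with hu | hv
  · exact hu (ofAdd.injective (hπα.symm.trans (hall _)))
  · exact hv (ofAdd.injective (hπβ.symm.trans (hall _)))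

end Metacyclic

theorem Int.exists_mul_eq_and_dvd_iff {N m z u t : ℤ} (hm : m ≠ 0) :
    (∃ q, z = m * q ∧ N ∣ u + t * q) ↔ m ∣ z ∧ N ∣ u + t * (z / m) := by
  constructor
  · rintro ⟨q, rfl, h⟩
    exact ⟨dvd_mul_right _ _, by rwa [Int.mul_ediv_cancel_left _ hm]⟩
  · rintro ⟨⟨q, rfl⟩, h⟩
    exact ⟨q, rfl, by rwa [Int.mul_ediv_cancel_left _ hm] at h⟩

/-- Lemma 2.2: for `H = H(2^a, 2^b; 2^c, 2^d + 1)` of type I (`r = 2^d + 1`), there is an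
automorphism `σ` with `σ(α) = α^(x₁) β^(y₁)` and `σ(β) = α^(x₂) β^(y₂)` iff conditions
(2.4)–(2.7) hold.  Powers `r^k` are computed with exponent the nonnegative remainder of `k`
mod `2^b`, and `[k; s] = 1 + s + ⋯ + s^(k-1)`. -/
theorem typeI_aut_exists_iff (a b c d : ℕ) (hd : 1 < d) (hdc : d < c) (hac : a - d - 1 < c)
    (hca : c < a) (hcb : c < b) (x₁ x₂ y₁ y₂ : ℤ) :
    letI H := Metacyclic (2 ^ a) (2 ^ b) (2 ^ c) (2 ^ d + 1)
    letI α : H := PresentedGroup.of true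
    letI β : H := PresentedGroup.of false
    letI r : ℤ := 2 ^ d + 1
    letI R : ℤ → ℤ := fun k => r ^ (k % 2 ^ b).toNat
    ((∃ σ : MulAut H, σ α = α ^ x₁ * β ^ y₁ ∧ σ β = α ^ x₂ * β ^ y₂) ↔
      ((2 : ℤ) ^ (b - d) ∣ y₁ ∧
        x₂ * (∑ i ∈ Finset.range (2 ^ b), R y₂ ^ i) + 2 ^ c * y₂
            - x₁ * (∑ i ∈ Finset.range (2 ^ c), R y₁ ^ i)
            - (2 ^ c * y₁ / 2 ^ b) * 2 ^ c ≡ 0 [ZMOD 2 ^ a] ∧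
        (R y₁ - 1) * x₂
            + ((∑ i ∈ Finset.range (2 ^ d + 1), R y₁ ^ i) - R y₂) * x₁
            + ((r - 1) * y₁ / 2 ^ b) * 2 ^ c ≡ 0 [ZMOD 2 ^ a] ∧
        Odd (x₁ * y₂ - x₂ * y₁))) := by
  let H := Metacyclic (2 ^ a) (2 ^ b) (2 ^ c) (2 ^ d + 1)
  let α : H := PresentedGroup.of true
  let β : H := PresentedGroup.of false
  let r : ℤ := 2 ^ d + 1
  let R : ℤ → ℤ := fun k => r ^ (k % 2 ^ b).toNat
  have hm0 : 2 ^ b ≠ 0 := by simp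
  have hmz : (2 : ℤ) ^ b ≠ 0 := by simp
  have hgen : IsMetacyclicPair (2 ^ a) (2 ^ b) (2 ^ c) (2 ^ d + 1) α β :=
    Metacyclic.isMetacyclicPair_of _ _ _ _
  have hrcast : ((2 ^ d + 1 : ℕ) : ℤ) = r := by push_cast; rfl
  have hrodd : Odd r := (even_two.pow_of_ne_zero (by omega)).add_one
  have hRodd : ∀ k, Odd (R k) := fun k => hrodd.pow
  have hr : IsCoprime ((2 ^ d + 1 : ℕ) : ℤ) (2 ^ a : ℕ) := by
    rw [hrcast]
    push_cast
    exact (Int.isCoprime_two_right.mpr hrodd).pow_right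
  have hm : ((2 ^ a : ℕ) : ℤ) ∣ ((2 ^ d + 1 : ℕ) : ℤ) ^ 2 ^ b - 1 := by
    push_cast
    exact (pow_dvd_pow 2 (by omega)).trans (two_pow_dvd_pow_two_pow_sub_one d b (by omega))
  have ht : ((2 ^ a : ℕ) : ℤ) ∣ ((2 ^ c : ℕ) : ℤ) * (((2 ^ d + 1 : ℕ) : ℤ) - 1) := by
    push_cast
    rw [add_sub_cancel_right, ← pow_add]
    exact pow_dvd_pow 2 (by omega)
  have hnf : ∀ i j k l : ℤ, α ^ i * β ^ j = α ^ k * β ^ l ↔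
      (2 : ℤ) ^ b ∣ j - l ∧ (2 : ℤ) ^ a ∣ i - k + 2 ^ c * ((j - l) / 2 ^ b) := by
    intro i j k l
    rw [← Int.exists_mul_eq_and_dvd_iff hmz]
    simpa using Metacyclic.zpow_mul_zpow_eq_iff hr hm ht (i := i) (j := j) (k := k) (l := l)
  have hpow : ∀ (i j : ℤ) (N : ℕ),
      (α ^ i * β ^ j) ^ N = α ^ (i * ∑ l ∈ range N, R j ^ l) * β ^ (j * N) := by
    intro i j N
    simpa using hgen.mul_zpow_pow hm0 i j N
  have hmul : ∀ i j k l : ℤ,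
      α ^ i * β ^ j * (α ^ k * β ^ l) = α ^ (i + R j * k) * β ^ (j + l) := by
    intro i j k l
    simpa using hgen.mul_zpow_mul_mul_zpow hm0 i j k l
  set A := α ^ x₁ * β ^ y₁ with hA
  set B := α ^ x₂ * β ^ y₂ with hB
  have hbd : (2 : ℤ) ^ (b - d) ∣ y₁ ↔ (2 : ℤ) ^ b ∣ (r - 1) * y₁ := by
    have : (2 : ℤ) ^ b = 2 ^ d * 2 ^ (b - d) := by rw [← pow_add]; congr 1; omega
    rw [this, show r - 1 = 2 ^ d from add_sub_cancel_right _ _,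
      mul_dvd_mul_iff_left (by simp)]
  have hbc : (2 : ℤ) ^ (b - d) ∣ y₁ → (2 : ℤ) ^ b ∣ 2 ^ c * y₁ := fun h => by
    have : (2 : ℤ) ^ b ∣ 2 ^ c * 2 ^ (b - d) := by
      rw [← pow_add]; exact pow_dvd_pow 2 (by omega)
    exact this.trans (mul_dvd_mul_left _ h)
  have hrel1 : (2 : ℤ) ^ (b - d) ∣ y₁ → A ^ 2 ^ a = 1 := by
    rintro ⟨k, hk⟩
    have hy : y₁ * (2 ^ a : ℕ) = 2 ^ b * (2 ^ (a - d) * k) := by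
      rw [hk]
      push_cast
      have e1 : (2 : ℤ) ^ b = 2 ^ d * 2 ^ (b - d) := by rw [← pow_add]; congr 1; omega
      have e2 : (2 : ℤ) ^ a = 2 ^ d * 2 ^ (a - d) := by rw [← pow_add]; congr 1; omega
      rw [e1, e2]; ring
    rw [hpow, show (1 : H) = α ^ (0 : ℤ) * β ^ (0 : ℤ) by simp, hnf, sub_zero, sub_zero, hy,
      Int.mul_ediv_cancel_left _ hmz]
    refine ⟨dvd_mul_right _ _, dvd_add ((two_pow_dvd_geom_sum_of_odd (hRodd _) a).mul_left _) ?_⟩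
    rw [← mul_assoc, ← pow_add]
    exact (pow_dvd_pow 2 (by omega)).mul_right k
  have hrel2 : (2 : ℤ) ^ (b - d) ∣ y₁ → (B ^ 2 ^ b = A ^ 2 ^ c ↔
      x₂ * (∑ i ∈ Finset.range (2 ^ b), R y₂ ^ i) + 2 ^ c * y₂
            - x₁ * (∑ i ∈ Finset.range (2 ^ c), R y₁ ^ i)
            - (2 ^ c * y₁ / 2 ^ b) * 2 ^ c ≡ 0 [ZMOD 2 ^ a]) := by
    intro h
    obtain ⟨k, hk⟩ := hbc h
    have hy : y₂ * (2 ^ b : ℕ) - y₁ * (2 ^ c : ℕ) = 2 ^ b * (y₂ - k) := by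
      push_cast
      linear_combination -hk
    rw [hpow, hpow, hnf, hy, Int.mul_ediv_cancel_left _ hmz, and_iff_right (dvd_mul_right _ _),
      hk, Int.mul_ediv_cancel_left _ hmz, Int.modEq_zero_iff_dvd]
    ring_nf
  have hrel3 : SemiconjBy B A (A ^ (2 ^ d + 1)) ↔ ((2 : ℤ) ^ (b - d) ∣ y₁ ∧
      (R y₁ - 1) * x₂
            + ((∑ i ∈ Finset.range (2 ^ d + 1), R y₁ ^ i) - R y₂) * x₁
            + ((r - 1) * y₁ / 2 ^ b) * 2 ^ c ≡ 0 [ZMOD 2 ^ a]) := by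
    have hy : y₂ + y₁ - (y₁ * ((2 ^ d + 1 : ℕ) : ℤ) + y₂) = -((r - 1) * y₁) := by
      rw [hrcast]; ring
    rw [SemiconjBy, hpow, hmul, hmul, hnf, hy, dvd_neg, ← hbd]
    refine and_congr_right fun h => ?_
    obtain ⟨k, hk⟩ := hbd.mp h
    have hR : R (y₁ * ((2 ^ d + 1 : ℕ) : ℤ)) = R y₁ := by
      have : y₁ * ((2 ^ d + 1 : ℕ) : ℤ) = y₁ + 2 ^ b * k := by
        rw [hrcast, ← hk]; ring
      simp only [R]
      rw [this, Int.add_mul_emod_self_left]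
    rw [hR, hk, ← mul_neg, Int.mul_ediv_cancel_left _ hmz, Int.mul_ediv_cancel_left _ hmz,
      Int.modEq_zero_iff_dvd, ← dvd_neg]
    ring_nf
  constructor
  · rintro ⟨σ, hσα, hσβ⟩
    have hpair : IsMetacyclicPair (2 ^ a) (2 ^ b) (2 ^ c) (2 ^ d + 1) A B := by
      have := hgen.map σ.toMonoidHom
      rwa [show σ.toMonoidHom α = A from hσα, show σ.toMonoidHom β = B from hσβ] at this
    obtain ⟨h1, h3⟩ := hrel3.mp hpair.semiconj
    refine ⟨h1, (hrel2 h1).mp hpair.pow_eq_pow, h3, ?_⟩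
    exact Metacyclic.odd_of_surjective (even_two.pow_of_ne_zero (by omega))
      (even_two.pow_of_ne_zero (by omega)) (even_two.pow_of_ne_zero (by omega))
      (even_two.pow_of_ne_zero (by omega)).add_one σ.toMonoidHom σ.surjective hσα hσβ
  · rintro ⟨h1, h2, h3, hodd⟩
    have hpair : IsMetacyclicPair (2 ^ a) (2 ^ b) (2 ^ c) (2 ^ d + 1) A B :=
      ⟨hrel1 h1, (hrel2 h1).mpr h2, hrel3.mpr ⟨h1, h3⟩⟩
    obtain ⟨f, hfα, hfβ⟩ := hpair.exists_hom
    have hsurj := Metacyclic.surjective_of_odd hodd f hfα hfβ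
    have : Finite H := Metacyclic.finite (by simp) hm0
    exact ⟨MulEquiv.ofBijective f
      (Finite.injective_iff_surjective.mpr hsurj |>.bijective_of_finite),
      hfα, hfβ⟩
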